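/- Let G be a graph with m edges, ℓ ∈ ℕ, α ∈ (0,1), and let ℓ-𝒟_G be the distribution placing mass 1/2 on the all-zeros input, 1/4 uniformly over the m generalized edge indicators ℓ-Ind[e], and 1/4 uniformly over the m(2ℓ+2) one-coordinate perturbations of generalized edge indicators. If T is a decision tree with Pr_{x ∼ ℓ-𝒟_G}[T(x) ≠ ℓ-IsEdge_G(x)] ≤ α/16, then the size of T is at least (ℓ+1)·(VC_α(G) + (1−α)m). -/

import Mathlib

open Classical

inductive DTree (α : Type) : Type where
  | leaf (b : Bool) : DTree α
  | node (i : α) (l r : DTree α) : DTree α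

def DTree.eval {α : Type} : DTree α → (α → Bool) → Bool
  | .leaf b, _ => b
  | .node i l r, x => if x i then r.eval x else l.eval x

def DTree.size {α : Type} : DTree α → ℕ
  | .leaf _ => 0
  | .node _ l r => 1 + l.size + r.size

noncomputable def ellInd {n : ℕ} (ℓ : ℕ) (e : Sym2 (Fin n)) :
    Fin (ℓ + 1) × Fin n → Bool :=
  fun p => decide (p.2 ∈ e)

noncomputable def ellIsEdge {n : ℕ} (ℓ : ℕ) (G : SimpleGraph (Fin n))
    (x : Fin (ℓ + 1) × Fin n → Bool) : Bool :=
  decide ((∃ e ∈ G.edgeSet, (fun i => x (0, i)) = fun i => decide (i ∈ e)) ∧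
    ∀ (j : Fin (ℓ + 1)) (i : Fin n), x (0, i) = true → x (j, i) = true)

/-- The error of T against ℓ-IsEdge_G under the distribution ℓ-𝒟_G, which puts mass 1/2 on
the all-zeros input, 1/4 uniformly over the m generalized edge indicators (mass 1/(4m) each),
and 1/4 uniformly over the m(2ℓ+2) one-coordinate perturbations of generalized edge
indicators (mass 1/(4m(2ℓ+2)) each). -/
noncomputable def ellDistErr {n : ℕ} (ℓ : ℕ) (G : SimpleGraph (Fin n))
    [DecidableRel G.Adj] (T : DTree (Fin (ℓ + 1) × Fin n)) : ℝ :=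
  (1 / 2) * (if T.eval (fun _ => false) ≠ ellIsEdge ℓ G (fun _ => false) then 1 else 0)
  + (1 / (4 * G.edgeFinset.card)) *
      ∑ e ∈ G.edgeFinset,
        (if T.eval (ellInd ℓ e) ≠ ellIsEdge ℓ G (ellInd ℓ e) then 1 else 0)
  + (1 / (4 * G.edgeFinset.card * (2 * ℓ + 2))) *
      ∑ e ∈ G.edgeFinset, ∑ j : Fin (ℓ + 1),
        ∑ i ∈ Finset.univ.filter (fun i : Fin n => i ∈ e),
          (if T.eval (Function.update (ellInd ℓ e) (j, i) false)
              ≠ ellIsEdge ℓ G (Function.update (ellInd ℓ e) (j, i) false) then 1 else 0)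

noncomputable def DTree.qry {α : Type} [DecidableEq α] : DTree α → (α → Bool) → Finset α
  | .leaf _, _ => ∅
  | .node i l r, x => insert i (if x i then r.qry x else l.qry x)

lemma DTree.qry_card_le {α : Type} [DecidableEq α] (T : DTree α) (x : α → Bool) :
    (T.qry x).card ≤ T.size := by
  induction T with
  | leaf b => simp [DTree.qry]
  | node i l r ihl ihr =>
    simp only [DTree.qry, DTree.size]
    refine (Finset.card_insert_le _ _).trans ?_
    split_ifs <;> omega

lemma DTree.eval_update {α : Type} [DecidableEq α] (T : DTree α) (x : α → Bool) (p : α) (b : Bool)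
    (hp : p ∉ T.qry x) : T.eval (Function.update x p b) = T.eval x := by
  induction T with
  | leaf b => simp [DTree.eval]
  | node i l r ihl ihr =>
    simp only [DTree.qry, Finset.mem_insert, not_or] at hp
    have h1 : Function.update x p b i = x i := Function.update_of_ne (Ne.symm hp.1) b x
    simp only [DTree.eval, h1]
    have h2 := hp.2
    split_ifs at h2 ⊢ with h
    · exact ihr h2
    · exact ihl h2

/-- queried coordinates at copies of u -/
noncomputable def qU {n ℓ : ℕ} (T : DTree (Fin (ℓ + 1) × Fin n)) (u : Fin n)
    (e : Sym2 (Fin n)) : ℕ :=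
  ((T.qry (ellInd ℓ e)).filter (fun p => p.2 = u)).card

/-- queried coordinates at copies of the endpoint of e other than u -/
noncomputable def qO {n ℓ : ℕ} (T : DTree (Fin (ℓ + 1) × Fin n)) (u : Fin n)
    (e : Sym2 (Fin n)) : ℕ :=
  ((T.qry (ellInd ℓ e)).filter (fun p => p.2 ∈ e ∧ p.2 ≠ u)).card

lemma qU_add_qO_le {n ℓ : ℕ} (T : DTree (Fin (ℓ + 1) × Fin n)) (u : Fin n)
    (e : Sym2 (Fin n)) : qO T u e + qU T u e ≤ T.size := by
  refine le_trans ?_ (T.qry_card_le (ellInd ℓ e))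
  unfold qU qO
  rw [← Finset.card_union_of_disjoint]
  · apply Finset.card_le_card
    intro p
    simp only [Finset.mem_union, Finset.mem_filter]
    tauto
  · rw [Finset.disjoint_left]
    intro p
    simp only [Finset.mem_filter]
    tauto

lemma qry_node_mem {n ℓ : ℕ} (p : Fin (ℓ + 1) × Fin n) (l r : DTree (Fin (ℓ + 1) × Fin n))
    (e : Sym2 (Fin n)) (h : p.2 ∈ e) :
    (DTree.node p l r).qry (ellInd ℓ e) = insert p (r.qry (ellInd ℓ e)) := by
  simp [DTree.qry, ellInd, h]

lemma qry_node_not_mem {n ℓ : ℕ} (p : Fin (ℓ + 1) × Fin n)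
    (l r : DTree (Fin (ℓ + 1) × Fin n)) (e : Sym2 (Fin n)) (h : p.2 ∉ e) :
    (DTree.node p l r).qry (ellInd ℓ e) = insert p (l.qry (ellInd ℓ e)) := by
  simp [DTree.qry, ellInd, h]

lemma card_filter_insert_le {β : Type} [DecidableEq β] (P : β → Prop) [DecidablePred P] (a : β) (s : Finset β) :
    ((insert a s).filter P).card ≤ (s.filter P).card + 1 := by
  rw [Finset.filter_insert]
  split_ifs
  · exact Finset.card_insert_le _ _
  · omega

lemma card_filter_insert_eq {β : Type} [DecidableEq β] (P : β → Prop) [DecidablePred P] (a : β) (s : Finset β) (h : ¬ P a) :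
    ((insert a s).filter P).card = (s.filter P).card := by
  rw [Finset.filter_insert, if_neg h]

lemma qU_node_mem_le {n ℓ : ℕ} (p : Fin (ℓ + 1) × Fin n)
    (l r : DTree (Fin (ℓ + 1) × Fin n)) (u : Fin n) (e : Sym2 (Fin n)) (h : p.2 ∈ e) :
    qU (DTree.node p l r) u e ≤ qU r u e + 1 := by
  unfold qU
  rw [qry_node_mem p l r e h]
  exact card_filter_insert_le _ _ _

lemma qU_node_mem_ne {n ℓ : ℕ} (p : Fin (ℓ + 1) × Fin n)
    (l r : DTree (Fin (ℓ + 1) × Fin n)) (u : Fin n) (e : Sym2 (Fin n)) (h : p.2 ∈ e)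
    (hu : p.2 ≠ u) : qU (DTree.node p l r) u e = qU r u e := by
  unfold qU
  rw [qry_node_mem p l r e h]
  exact card_filter_insert_eq (fun q : Fin (ℓ + 1) × Fin n => q.2 = u) p _ hu

lemma qO_node_mem_le {n ℓ : ℕ} (p : Fin (ℓ + 1) × Fin n)
    (l r : DTree (Fin (ℓ + 1) × Fin n)) (u : Fin n) (e : Sym2 (Fin n)) (h : p.2 ∈ e) :
    qO (DTree.node p l r) u e ≤ qO r u e + 1 := by
  unfold qO
  rw [qry_node_mem p l r e h]
  exact card_filter_insert_le _ _ _

lemma qO_node_mem_eq {n ℓ : ℕ} (p : Fin (ℓ + 1) × Fin n)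
    (l r : DTree (Fin (ℓ + 1) × Fin n)) (u : Fin n) (e : Sym2 (Fin n)) (h : p.2 ∈ e)
    (hu : p.2 = u) : qO (DTree.node p l r) u e = qO r u e := by
  unfold qO
  rw [qry_node_mem p l r e h]
  exact card_filter_insert_eq (fun q : Fin (ℓ + 1) × Fin n => q.2 ∈ e ∧ q.2 ≠ u) p _ (by simp [hu])

lemma qO_node_not_mem {n ℓ : ℕ} (p : Fin (ℓ + 1) × Fin n)
    (l r : DTree (Fin (ℓ + 1) × Fin n)) (u : Fin n) (e : Sym2 (Fin n)) (h : p.2 ∉ e) :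
    qO (DTree.node p l r) u e = qO l u e := by
  unfold qO
  rw [qry_node_not_mem p l r e h]
  exact card_filter_insert_eq (fun q : Fin (ℓ + 1) × Fin n => q.2 ∈ e ∧ q.2 ≠ u) p _ (by simp [h])

lemma qU_node_not_mem {n ℓ : ℕ} (p : Fin (ℓ + 1) × Fin n)
    (l r : DTree (Fin (ℓ + 1) × Fin n)) (u : Fin n) (e : Sym2 (Fin n)) (h : p.2 ∉ e)
    (hu : u ∈ e) : qU (DTree.node p l r) u e = qU l u e := by
  unfold qU
  rw [qry_node_not_mem p l r e h]
  exact card_filter_insert_eq (fun q : Fin (ℓ + 1) × Fin n => q.2 = u) p _ (by rintro rfl; exact h hu)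

/-- Lemma B: all edges share the vertex u. -/
lemma star_bound {n ℓ : ℕ} (u : Fin n) (T : DTree (Fin (ℓ + 1) × Fin n)) :
    ∀ (F : Finset (Sym2 (Fin n))), (∀ e ∈ F, u ∈ e) → ∀ e0 ∈ F,
      ∑ e ∈ F, qO T u e + qU T u e0 ≤ T.size := by
  induction T with
  | leaf b =>
    intro F hF e0 he0
    simp [qO, qU, DTree.qry]
  | node p l r ihl ihr =>
    intro F hF e0 he0
    simp only [DTree.size]
    by_cases hpu : p.2 = u
    · have h1 : ∑ e ∈ F, qO (DTree.node p l r) u e = ∑ e ∈ F, qO r u e :=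
        Finset.sum_congr rfl fun e he =>
          qO_node_mem_eq p l r u e (by rw [hpu]; exact hF e he) hpu
      have h2 := qU_node_mem_le p l r u e0 (by rw [hpu]; exact hF e0 he0)
      have h3 := ihr F hF e0 he0
      omega
    · by_cases hex : ∃ e1 ∈ F, p.2 ∈ e1
      · obtain ⟨e1, he1, hp1⟩ := hex
        have huniq : ∀ e ∈ F.erase e1, p.2 ∉ e := by
          intro e he hpe
          rw [Finset.mem_erase] at he
          apply he.1
          exact ((Sym2.mem_and_mem_iff hpu).1 ⟨hpe, hF e he.2⟩).trans
            ((Sym2.mem_and_mem_iff hpu).1 ⟨hp1, hF e1 he1⟩).symm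
        have hs := Finset.add_sum_erase F (fun e => qO (DTree.node p l r) u e) he1
        have h1 : ∑ e ∈ F.erase e1, qO (DTree.node p l r) u e = ∑ e ∈ F.erase e1, qO l u e :=
          Finset.sum_congr rfl fun e he => qO_node_not_mem p l r u e (huniq e he)
        have h2 := qO_node_mem_le p l r u e1 hp1
        have h3 := qU_add_qO_le r u e1
        have hF' : ∀ e ∈ F.erase e1, u ∈ e := fun e he => hF e (Finset.mem_of_mem_erase he)
        by_cases h01 : e0 = e1
        · subst h01
          have h4 := qU_node_mem_ne p l r u e0 hp1 hpu
          have h5 : ∑ e ∈ F.erase e0, qO l u e ≤ l.size := by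
            rcases (F.erase e0).eq_empty_or_nonempty with h | ⟨e2, he2⟩
            · simp [h]
            · have := ihl _ hF' e2 he2
              omega
          omega
        · have he0' : e0 ∈ F.erase e1 := Finset.mem_erase.2 ⟨h01, he0⟩
          have h4 := qU_node_not_mem p l r u e0 (huniq e0 he0') (hF e0 he0)
          have h5 := ihl _ hF' e0 he0'
          omega
      · push Not at hex
        have h1 : ∑ e ∈ F, qO (DTree.node p l r) u e = ∑ e ∈ F, qO l u e :=
          Finset.sum_congr rfl fun e he => qO_node_not_mem p l r u e (hex e he)
        have h2 := qU_node_not_mem p l r u e0 (hex e0 he0) (hF e0 he0)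
        have h3 := ihl F hF e0 he0
        omega

/-- Lemma C: edges whose evaluation differs from that of the zero input. -/
lemma spine_bound {n ℓ : ℕ} (T : DTree (Fin (ℓ + 1) × Fin n)) :
    ∀ (E : Finset (Sym2 (Fin n))),
      (∀ e ∈ E, T.eval (ellInd ℓ e) ≠ T.eval (fun _ => false)) →
      ∃ (f : Sym2 (Fin n) → Fin n) (R : Finset (Sym2 (Fin n))), R ⊆ E ∧
        (∀ e ∈ E, f e ∈ e) ∧ (∀ e ∈ E, ∃ e' ∈ R, f e' ∈ e) ∧
        ∑ e ∈ E, qO T (f e) e + ∑ e ∈ R, qU T (f e) e ≤ T.size := by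
  induction T with
  | leaf b =>
    intro E hE
    have hE0 : E = ∅ := by
      apply Finset.eq_empty_of_forall_notMem
      intro e he
      exact hE e he rfl
    subst hE0
    exact ⟨fun e => e.out.1, ∅, by simp⟩
  | node p l r ihl ihr =>
    intro E hE
    have hEl : ∀ e ∈ E.filter (fun e => p.2 ∉ e),
        l.eval (ellInd ℓ e) ≠ l.eval (fun _ => false) := by
      intro e he
      rw [Finset.mem_filter] at he
      have := hE e he.1
      simpa [DTree.eval, ellInd, he.2] using this
    obtain ⟨f, R, hR, hf, hcov, hsz⟩ := ihl _ hEl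
    have hRl : ∀ e ∈ R, p.2 ∉ e := fun e he => (Finset.mem_filter.1 (hR he)).2
    have hsplit : ∀ g : Sym2 (Fin n) → ℕ, ∑ e ∈ E, g e =
        ∑ e ∈ E.filter (fun e => p.2 ∈ e), g e + ∑ e ∈ E.filter (fun e => p.2 ∉ e), g e :=
      fun g => (Finset.sum_filter_add_sum_filter_not E _ g).symm
    let f' : Sym2 (Fin n) → Fin n := fun e => if p.2 ∈ e then p.2 else f e
    have hfa : ∀ e, p.2 ∈ e → f' e = p.2 := fun e he => if_pos he
    have hfb : ∀ e, p.2 ∉ e → f' e = f e := fun e he => if_neg he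
    have hf' : ∀ e ∈ E, f' e ∈ e := by
      intro e he
      by_cases h : p.2 ∈ e
      · rw [hfa e h]; exact h
      · rw [hfb e h]; exact hf e (Finset.mem_filter.2 ⟨he, h⟩)
    have hcovl : ∀ e ∈ E, p.2 ∉ e → ∃ e' ∈ R, f' e' ∈ e := by
      intro e he h
      obtain ⟨e', h1, h2⟩ := hcov e (Finset.mem_filter.2 ⟨he, h⟩)
      exact ⟨e', h1, by rw [hfb e' (hRl e' h1)]; exact h2⟩
    have hO1 : ∑ e ∈ E.filter (fun e => p.2 ∉ e), qO (DTree.node p l r) (f' e) e =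
        ∑ e ∈ E.filter (fun e => p.2 ∉ e), qO l (f e) e := by
      refine Finset.sum_congr rfl fun e he => ?_
      have h := (Finset.mem_filter.1 he).2
      rw [hfb e h, qO_node_not_mem p l r _ e h]
    have hU1 : ∑ e ∈ R, qU (DTree.node p l r) (f' e) e = ∑ e ∈ R, qU l (f e) e := by
      refine Finset.sum_congr rfl fun e he => ?_
      rw [hfb e (hRl e he), qU_node_not_mem p l r _ e (hRl e he) (hf e (hR he))]
    have hO2 : ∑ e ∈ E.filter (fun e => p.2 ∈ e), qO (DTree.node p l r) (f' e) e =
        ∑ e ∈ E.filter (fun e => p.2 ∈ e), qO r p.2 e := by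
      refine Finset.sum_congr rfl fun e he => ?_
      have h := (Finset.mem_filter.1 he).2
      rw [hfa e h, qO_node_mem_eq p l r _ e h rfl]
    have hRE : R ⊆ E := hR.trans (Finset.filter_subset _ _)
    have hs := hsplit (fun e => qO (DTree.node p l r) (f' e) e)
    rcases (E.filter (fun e => p.2 ∈ e)).eq_empty_or_nonempty with h0 | ⟨e0, he0⟩
    · refine ⟨f', R, hRE, hf', ?_, ?_⟩
      · intro e he
        apply hcovl e he
        intro h
        have : e ∈ E.filter (fun e => p.2 ∈ e) := Finset.mem_filter.2 ⟨he, h⟩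
        rw [h0] at this
        simp at this
      · rw [h0] at hs hO2
        simp only [Finset.sum_empty] at hs
        simp only [DTree.size]
        omega
    · have hst := star_bound p.2 r (E.filter (fun e => p.2 ∈ e))
        (fun e he => (Finset.mem_filter.1 he).2) e0 he0
      have he0' := Finset.mem_filter.1 he0
      have hnot : e0 ∉ R := fun h => hRl e0 h he0'.2
      refine ⟨f', insert e0 R, ?_, hf', ?_, ?_⟩
      · exact Finset.insert_subset he0'.1 hRE
      · intro e he
        by_cases h : p.2 ∈ e
        · exact ⟨e0, Finset.mem_insert_self _ _, by rw [hfa e0 he0'.2]; exact h⟩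
        · obtain ⟨e', h1, h2⟩ := hcovl e he h
          exact ⟨e', Finset.mem_insert_of_mem h1, h2⟩
      · rw [Finset.sum_insert hnot, hfa e0 he0'.2]
        have := qU_node_mem_le p l r p.2 e0 he0'.2
        simp only [DTree.size]
        omega

lemma ellIsEdge_zero {n : ℕ} (ℓ : ℕ) (G : SimpleGraph (Fin n)) :
    ellIsEdge ℓ G (fun _ => false) = false := by
  unfold ellIsEdge
  rw [decide_eq_false_iff_not]
  rintro ⟨⟨e, -, h⟩, -⟩
  have := congrFun h e.out.1
  simp [Sym2.out_fst_mem] at this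

lemma ellIsEdge_ind {n : ℕ} (ℓ : ℕ) (G : SimpleGraph (Fin n)) (e : Sym2 (Fin n))
    (he : e ∈ G.edgeSet) : ellIsEdge ℓ G (ellInd ℓ e) = true := by
  unfold ellIsEdge
  rw [decide_eq_true_iff]
  exact ⟨⟨e, he, rfl⟩, fun j i h => h⟩

lemma ellIsEdge_pert {n : ℕ} (ℓ : ℕ) (G : SimpleGraph (Fin n)) (e : Sym2 (Fin n))
    (j : Fin (ℓ + 1)) (i : Fin n) (hi : i ∈ e) :
    ellIsEdge ℓ G (Function.update (ellInd ℓ e) (j, i) false) = false := by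
  unfold ellIsEdge
  rw [decide_eq_false_iff_not]
  rintro ⟨⟨e', he', h⟩, h2⟩
  by_cases hj : j = 0
  · subst hj
    induction e' with
    | _ a b =>
      have hab : a ≠ b := G.ne_of_adj he'
      obtain ⟨w, rfl⟩ := hi
      have ha := congrFun h a
      have hb := congrFun h b
      simp only [Function.update_apply, ellInd] at ha hb
      simp at ha hb
      apply hab
      rw [ha.2.resolve_left ha.1, hb.2.resolve_left hb.1]
  · have h3 := h2 j i
    have hne : ((0 : Fin (ℓ + 1)), i) ≠ (j, i) := by
      intro h
      exact hj (congrArg Prod.fst h).symm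
    simp [Function.update_of_ne hne, ellInd, hi] at h3

/-- number of misclassified perturbations of e -/
noncomputable def pertErr {n ℓ : ℕ} (T : DTree (Fin (ℓ + 1) × Fin n))
    (P : Fin n → Prop) (e : Sym2 (Fin n)) : ℕ :=
  (Finset.univ.filter (fun p : Fin (ℓ + 1) × Fin n => P p.2 ∧
    T.eval (Function.update (ellInd ℓ e) p false) = true)).card

lemma card_le_qry {n ℓ : ℕ} (T : DTree (Fin (ℓ + 1) × Fin n)) (P : Fin n → Prop)
    (e : Sym2 (Fin n)) (he : T.eval (ellInd ℓ e) = true) (a : Fin n) (ha : P a) :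
    ℓ + 1 ≤ ((T.qry (ellInd ℓ e)).filter (fun p => P p.2)).card + pertErr T P e := by
  unfold pertErr
  refine le_trans ?_ (Finset.card_union_le _ _)
  have : (Finset.univ.image (fun j : Fin (ℓ + 1) => (j, a))).card = ℓ + 1 := by
    rw [Finset.card_image_of_injective]
    · simp
    · intro x y h
      exact congrArg Prod.fst h
  refine this.symm.le.trans ?_
  apply Finset.card_le_card
  intro p hp
  simp only [Finset.mem_image, Finset.mem_univ, true_and] at hp
  obtain ⟨j, rfl⟩ := hp
  simp only [Finset.mem_union, Finset.mem_filter, Finset.mem_univ, true_and]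
  by_cases hq : (j, a) ∈ T.qry (ellInd ℓ e)
  · exact Or.inl ⟨hq, ha⟩
  · exact Or.inr ⟨ha, by rw [T.eval_update _ _ _ hq, he]⟩

lemma pertErr_split {n ℓ : ℕ} (T : DTree (Fin (ℓ + 1) × Fin n)) (u : Fin n)
    (e : Sym2 (Fin n)) (hu : u ∈ e) :
    pertErr T (fun a => a ∈ e ∧ a ≠ u) e + pertErr T (fun a => a = u) e
      ≤ pertErr T (fun a => a ∈ e) e := by
  unfold pertErr
  rw [← Finset.card_union_of_disjoint]
  · apply Finset.card_le_card
    intro p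
    simp only [Finset.mem_union, Finset.mem_filter, Finset.mem_univ, true_and]
    rintro (h | ⟨rfl, h⟩)
    · exact ⟨h.1.1, h.2⟩
    · exact ⟨hu, h⟩
  · rw [Finset.disjoint_left]
    intro p
    simp only [Finset.mem_filter]
    tauto

lemma size_bound {n ℓ : ℕ} (T : DTree (Fin (ℓ + 1) × Fin n)) (E : Finset (Sym2 (Fin n)))
    (hd : ∀ e ∈ E, ¬ e.IsDiag) (h0 : T.eval (fun _ => false) = false)
    (hE : ∀ e ∈ E, T.eval (ellInd ℓ e) = true) :
    ∃ C : Finset (Fin n), (∀ e ∈ E, ∃ v ∈ C, v ∈ e) ∧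
      (ℓ + 1) * E.card + (ℓ + 1) * C.card
        ≤ T.size + ∑ e ∈ E, pertErr T (fun a => a ∈ e) e := by
  obtain ⟨f, R, hR, hf, hcov, hsz⟩ := spine_bound T E (by
    intro e he
    rw [hE e he, h0]
    simp)
  refine ⟨R.image f, ?_, ?_⟩
  · intro e he
    obtain ⟨e', h1, h2⟩ := hcov e he
    exact ⟨f e', Finset.mem_image_of_mem _ h1, h2⟩
  · have hO : (ℓ + 1) * E.card ≤ ∑ e ∈ E, qO T (f e) e +
        ∑ e ∈ E, pertErr T (fun a => a ∈ e ∧ a ≠ f e) e := by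
      rw [← Finset.sum_add_distrib, mul_comm, ← smul_eq_mul]
      apply Finset.card_nsmul_le_sum
      intro e he
      have := card_le_qry T (fun a => a ∈ e ∧ a ≠ f e) e (hE e he) (Sym2.Mem.other (hf e he))
        ⟨Sym2.other_mem _, Sym2.other_ne (hd e he) _⟩
      unfold qO
      refine this.trans (le_of_eq ?_)
      congr!
    have hU : (ℓ + 1) * R.card ≤ ∑ e ∈ R, qU T (f e) e +
        ∑ e ∈ R, pertErr T (fun a => a = f e) e := by
      rw [← Finset.sum_add_distrib, mul_comm, ← smul_eq_mul]
      apply Finset.card_nsmul_le_sum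
      intro e he
      have := card_le_qry T (fun a => a = f e) e (hE e (hR he)) (f e) rfl
      unfold qU
      refine this.trans (le_of_eq ?_)
      congr!
    have hRE : ∑ e ∈ R, pertErr T (fun a => a = f e) e ≤
        ∑ e ∈ E, pertErr T (fun a => a = f e) e := Finset.sum_le_sum_of_subset hR
    have hsum : ∑ e ∈ E, pertErr T (fun a => a ∈ e ∧ a ≠ f e) e +
        ∑ e ∈ E, pertErr T (fun a => a = f e) e ≤ ∑ e ∈ E, pertErr T (fun a => a ∈ e) e := by
      rw [← Finset.sum_add_distrib]
      exact Finset.sum_le_sum fun e he => pertErr_split T (f e) e (hf e he)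
    have hc : (ℓ + 1) * (R.image f).card ≤ (ℓ + 1) * R.card :=
      Nat.mul_le_mul_left _ Finset.card_image_le
    omega

lemma pert_sum {n : ℕ} (ℓ : ℕ) (G : SimpleGraph (Fin n))
    (T : DTree (Fin (ℓ + 1) × Fin n)) (e : Sym2 (Fin n)) :
    (∑ j : Fin (ℓ + 1),
        ∑ i ∈ Finset.univ.filter (fun i : Fin n => i ∈ e),
          (if T.eval (Function.update (ellInd ℓ e) (j, i) false)
              ≠ ellIsEdge ℓ G (Function.update (ellInd ℓ e) (j, i) false) then (1 : ℝ) else 0))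
      = (pertErr T (fun a => a ∈ e) e : ℝ) := by
  unfold pertErr
  rw [Finset.card_filter, Nat.cast_sum, Fintype.sum_prod_type]
  refine Finset.sum_congr rfl fun j _ => ?_
  rw [Finset.sum_filter]
  refine Finset.sum_congr rfl fun i _ => ?_
  by_cases hi : i ∈ e
  · rw [ellIsEdge_pert ℓ G e j i hi]
    simp [hi]
  · simp [hi]

/-- if Pr_{x ∼ ℓ-𝒟_G}[T(x) ≠ ℓ-IsEdge_G(x)] ≤ α/16, then
|T| ≥ (ℓ+1)·(VC_α(G) + (1−α)m), where VC_α(G) is the minimum size of an α-partial vertex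
cover of G. -/
theorem stmt19 {n : ℕ} (G : SimpleGraph (Fin n)) [DecidableRel G.Adj] (ℓ : ℕ)
    (α : ℝ) (hα0 : 0 < α) (hα1 : α < 1)
    (T : DTree (Fin (ℓ + 1) × Fin n))
    (hT : ellDistErr ℓ G T ≤ α / 16) :
    ((ℓ : ℝ) + 1) *
        (((sInf {k : ℕ | ∃ C : Finset (Fin n),
            ((G.edgeFinset.filter (fun e => ∀ v ∈ C, v ∉ e)).card : ℝ)
              ≤ α * G.edgeFinset.card ∧ C.card = k} : ℕ) : ℝ)
          + (1 - α) * G.edgeFinset.card)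
      ≤ T.size := by
  have hd : ∀ e ∈ G.edgeFinset, ¬ e.IsDiag := fun e he =>
    G.not_isDiag_of_mem_edgeFinset he
  have hsum2 : ∀ s : Finset (Sym2 (Fin n)), (∑ e ∈ s, ∑ j : Fin (ℓ + 1),
        ∑ i ∈ Finset.univ.filter (fun i : Fin n => i ∈ e),
          (if T.eval (Function.update (ellInd ℓ e) (j, i) false)
              ≠ ellIsEdge ℓ G (Function.update (ellInd ℓ e) (j, i) false) then (1 : ℝ) else 0))
      = ((∑ e ∈ s, pertErr T (fun a => a ∈ e) e : ℕ) : ℝ) := by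
    intro s
    rw [Nat.cast_sum]
    exact Finset.sum_congr rfl fun e _ => pert_sum ℓ G T e
  have hsum1 : (∑ e ∈ G.edgeFinset,
        (if T.eval (ellInd ℓ e) ≠ ellIsEdge ℓ G (ellInd ℓ e) then (1 : ℝ) else 0))
      = ((G.edgeFinset.filter (fun e => ¬ T.eval (ellInd ℓ e) = true)).card : ℝ) := by
    rw [Finset.card_filter, Nat.cast_sum]
    refine Finset.sum_congr rfl fun e he => ?_
    rw [ellIsEdge_ind ℓ G e (SimpleGraph.mem_edgeFinset.1 he)]
    by_cases h : T.eval (ellInd ℓ e) = true <;> simp [h]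
  unfold ellDistErr at hT
  rw [hsum1, hsum2, ellIsEdge_zero] at hT
  have hcard := Finset.card_filter_add_card_filter_not (s := G.edgeFinset)
    (fun e => T.eval (ellInd ℓ e) = true)
  set E := G.edgeFinset.filter (fun e => T.eval (ellInd ℓ e) = true) with hEdef
  set B := G.edgeFinset.filter (fun e => ¬ T.eval (ellInd ℓ e) = true) with hBdef
  set m := G.edgeFinset.card with hm
  set X := ∑ e ∈ G.edgeFinset, pertErr T (fun a => a ∈ e) e with hX
  have h0 : T.eval (fun _ => false) = false := by
    by_contra h
    rw [if_pos h] at hT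
    have h1 : (0 : ℝ) ≤ 1 / (4 * (m : ℝ)) * (B.card : ℝ) := by positivity
    have h2 : (0 : ℝ) ≤ 1 / (4 * (m : ℝ) * (2 * ℓ + 2)) * (X : ℝ) := by positivity
    linarith
  obtain ⟨C, hC, hsz⟩ := size_bound T E (fun e he => hd e (Finset.mem_filter.1 he).1) h0
    (fun e he => (Finset.mem_filter.1 he).2)
  have hXE : ∑ e ∈ E, pertErr T (fun a => a ∈ e) e ≤ X :=
    Finset.sum_le_sum_of_subset (Finset.filter_subset _ _)
  have hvc : sInf {k : ℕ | ∃ C : Finset (Fin n),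
            ((G.edgeFinset.filter (fun e => ∀ v ∈ C, v ∉ e)).card : ℝ)
              ≤ α * m ∧ C.card = k} ≤ C.card + B.card := by
    refine le_trans (Nat.sInf_le ⟨C ∪ B.image (fun e => e.out.1), ?_, rfl⟩) ?_
    · have : G.edgeFinset.filter
          (fun e => ∀ v ∈ C ∪ B.image (fun e => e.out.1), v ∉ e) = ∅ := by
        apply Finset.filter_eq_empty_iff.2
        intro e he hall
        by_cases h : T.eval (ellInd ℓ e) = true
        · obtain ⟨v, hv, hve⟩ := hC e (Finset.mem_filter.2 ⟨he, h⟩)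
          exact hall v (Finset.mem_union_left _ hv) hve
        · exact hall e.out.1 (Finset.mem_union_right _
            (Finset.mem_image_of_mem _ (Finset.mem_filter.2 ⟨he, h⟩))) (Sym2.out_fst_mem e)
      rw [this]
      simp only [Finset.card_empty, Nat.cast_zero]
      positivity
    · refine (Finset.card_union_le _ _).trans ?_
      have := Finset.card_image_le (s := B) (f := fun e => e.out.1)
      omega
  set K := sInf {k : ℕ | ∃ C : Finset (Fin n),
            ((G.edgeFinset.filter (fun e => ∀ v ∈ C, v ∉ e)).card : ℝ)
              ≤ α * m ∧ C.card = k} with hK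
  have hsz' : ((ℓ : ℝ) + 1) * E.card + (ℓ + 1) * C.card ≤ T.size + X := by
    have := hsz.trans (Nat.add_le_add_left hXE _)
    exact_mod_cast this
  have hcard' : (E.card : ℝ) + B.card = m := by exact_mod_cast hcard
  have hvc' : (K : ℝ) ≤ C.card + B.card := by exact_mod_cast hvc
  have hl : (0 : ℝ) < (ℓ : ℝ) + 1 := by positivity
  have hkey : 2 * ((ℓ : ℝ) + 1) * B.card + X ≤ α * m * (ℓ + 1) := by
    rcases Nat.eq_zero_or_pos m with h | h
    · have hE0 : G.edgeFinset = ∅ := Finset.card_eq_zero.1 h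
      have hB0 : B.card = 0 := by omega
      have hX0 : X = 0 := by rw [hX, hE0]; simp
      rw [h, hB0, hX0]
      simp
    · have hm' : (0 : ℝ) < m := by exact_mod_cast h
      rw [h0] at hT
      simp only [ne_eq, not_true_eq_false, if_false, mul_zero, zero_add] at hT
      have e1 : 1 / (4 * (m : ℝ)) * (B.card : ℝ) + 1 / (4 * (m : ℝ) * (2 * ℓ + 2)) * (X : ℝ)
          = (2 * ((ℓ : ℝ) + 1) * B.card + X) / (8 * m * (ℓ + 1)) := by
        field_simp
        ring
      rw [e1, div_le_iff₀ (by positivity)] at hT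
      have : 0 ≤ α * m * ((ℓ : ℝ) + 1) := by positivity
      linarith
  have h7 := mul_le_mul_of_nonneg_left hvc' hl.le
  have h8 : (E.card : ℝ) = m - B.card := by linarith
  rw [h8] at hsz'
  linarith
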